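/- Let d ≥ 2, α ∈ (0,1), and let μ be a nondegenerate α-stable distribution on ℝ^d with no shift, characteristic exponent Φ_μ(z) = |z|^α V(u_z), and density g. Then for every n ∈ ℤ_+, as x → 0, g(x) = (2^{1−d}/(π^{d/2} α)) Σ_{k=0}^n Γ((k+d)/α) (|x|/2)^k Σ_{m=0}^{⌊k/2⌋} (−1)^m S_{k−2m, −(k+d)/α}(u_x) / (m! Γ(k−m+d/2)) + O(|x|^{n+1}), where S_{j,p} = (−i)^j proj_j(V^p) with the principal branch of the complex power. In particular g(0) = (Γ(d/α)/(α (2π)^d)) ∫_{S^{d−1}} V^{−d/α} dω. -/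

import Mathlib

open MeasureTheory Real Filter Topology
open scoped RealInnerProductSpace ENNReal NNReal

noncomputable section

namespace StablePaper

abbrev Ed (d : ℕ) : Type := EuclideanSpace ℝ (Fin d)

abbrev Sph (d : ℕ) := Metric.sphere (0 : Ed d) 1

/-- The surface measure `ω` on the unit sphere `S^{d-1}`. -/
def ωd (d : ℕ) : Measure (Sph d) := (volume : Measure (Ed d)).toSphere

/-- `u_z = z/|z|` for `z ≠ 0`, as a point of the unit sphere. -/
def unitize {d : ℕ} (z : Ed d) (hz : z ≠ 0) : Sph d :=
  ⟨‖z‖⁻¹ • z, by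
    rw [mem_sphere_iff_norm, sub_zero, norm_smul, norm_inv, norm_norm,
      inv_mul_cancel₀ (norm_ne_zero_iff.mpr hz)]⟩

/-- Negation on the unit sphere. -/
def negS {d : ℕ} (u : Sph d) : Sph d :=
  ⟨-(u : Ed d), by
    rw [mem_sphere_iff_norm, sub_zero, norm_neg]
    have := u.2
    rwa [mem_sphere_iff_norm, sub_zero] at this⟩

/-- Rising factorial (Pochhammer symbol) `(b)_n`. -/
def risingFactorial (b : ℝ) (n : ℕ) : ℝ := ∏ i ∈ Finset.range n, (b + i)

/-- The Gegenbauer polynomial `C_j^b(t)` (for `b > 0`), via its explicit sum formula. -/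
def gegenbauer (b : ℝ) (j : ℕ) (t : ℝ) : ℝ :=
  ∑ m ∈ Finset.range (j / 2 + 1),
    (-1 : ℝ) ^ m * 2 ^ (j - 2 * m) * risingFactorial b (j - m) /
      ((Nat.factorial m : ℝ) * (Nat.factorial (j - 2 * m) : ℝ)) * t ^ (j - 2 * m)

/-- The normalized (ultraspherical) polynomial `C̃_j^b(t) = C_j^b(t)/C_j^b(1)`;
for `b = 0` it is the Chebyshev polynomial `T_j`. -/
def gegenbauerN (b : ℝ) (j : ℕ) (t : ℝ) : ℝ :=
  if b = 0 then (Polynomial.Chebyshev.T ℝ (j : ℤ)).eval t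
  else gegenbauer b j t / gegenbauer b j 1

/-- `c_{j,d} = dim ℋ_{j,d}`. -/
def cdim (d j : ℕ) : ℕ :=
  if j = 0 then 1 else Nat.choose (j + d - 2) j + Nat.choose (j + d - 3) (j - 1)

/-- The surface area `A(S^{d-1}) = 2 π^{d/2} / Γ(d/2)`. -/
def sphereArea (d : ℕ) : ℝ := 2 * Real.pi ^ ((d : ℝ) / 2) / Real.Gamma ((d : ℝ) / 2)

/-- Projection onto spherical harmonics of degree `j` (real-valued version):
`(proj_j f)(u) = (c_{j,d}/A(S^{d-1})) ∫ C̃_j^{(d-2)/2}(⟨u,v⟩) f(v) ω(dv)`. -/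
def projR (d j : ℕ) (f : Sph d → ℝ) (u : Sph d) : ℝ :=
  (cdim d j : ℝ) / sphereArea d *
    ∫ v, gegenbauerN (((d : ℝ) - 2) / 2) j ⟪(u : Ed d), (v : Ed d)⟫ * f v ∂(ωd d)

/-- Projection onto spherical harmonics of degree `j` (complex-valued version). -/
def projC (d j : ℕ) (f : Sph d → ℂ) (u : Sph d) : ℂ :=
  ((cdim d j : ℂ) / (sphereArea d : ℂ)) *
    ∫ v, (gegenbauerN (((d : ℝ) - 2) / 2) j ⟪(u : Ed d), (v : Ed d)⟫ : ℂ) * f v ∂(ωd d)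

/-- The coefficients `w_j(α)`. -/
def w (d : ℕ) (α : ℝ) (j : ℕ) : ℝ :=
  Real.pi ^ ((d : ℝ) / 2) * Real.Gamma (α + 1) /
    (2 ^ (α - 1) * Real.Gamma (((j : ℝ) + α + d) / 2) * Real.Gamma ((α - j) / 2 + 1))

/-- The characteristic exponent of an `α`-stable distribution (`α ≠ 1`) with
spectral spherical measure `Λ`. -/
def charExp (d : ℕ) (α : ℝ) (Λ : Measure (Sph d)) (z : Ed d) : ℂ :=
  ∫ v, (|⟪z, (v : Ed d)⟫| ^ α : ℝ) *
      (1 - Complex.I * (Real.tan (Real.pi * α / 2) : ℂ) *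
        (Real.sign ⟪z, (v : Ed d)⟫ : ℂ)) ∂Λ

/-- `V(u)`, so that `Φ_μ(z) = |z|^α V(u_z)`. -/
def Vfun (d : ℕ) (α : ℝ) (Λ : Measure (Sph d)) (u : Sph d) : ℂ :=
  charExp d α Λ (u : Ed d)

/-- The characteristic exponent of a `1`-stable distribution with
spectral spherical measure `Λ`. -/
def charExp1 (d : ℕ) (Λ : Measure (Sph d)) (z : Ed d) : ℂ :=
  ∫ v, ((|⟪z, (v : Ed d)⟫| : ℝ) : ℂ) +
      Complex.I * ((2 / Real.pi * (⟪z, (v : Ed d)⟫ *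
        Real.log |⟪z, (v : Ed d)⟫|) : ℝ) : ℂ) ∂Λ

/-- The spectral spherical measure `λ(dv) = P(v) ω(dv)`. -/
def specMeasure (d : ℕ) (P : Sph d → ℝ) : Measure (Sph d) :=
  (ωd d).withDensity (fun v => ENNReal.ofReal (P v))

/-- `μ` has Fourier transform `exp (-Φ)` where `Φ` is the `α`-stable characteristic
exponent with spectral spherical measure `Λ` (case `α ≠ 1`). -/
def IsStableChar (d : ℕ) (α : ℝ) (Λ : Measure (Sph d)) (μ : Measure (Ed d)) : Prop :=
  ∀ z : Ed d, ∫ x, Complex.exp (Complex.I * (⟪z, x⟫ : ℂ)) ∂μ =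
    Complex.exp (- charExp d α Λ z)

/-- `μ` has Fourier transform `exp (-Φ)` where `Φ` is the `1`-stable characteristic
exponent with spectral spherical measure `Λ`. -/
def IsStableChar1 (d : ℕ) (Λ : Measure (Sph d)) (μ : Measure (Ed d)) : Prop :=
  ∀ z : Ed d, ∫ x, Complex.exp (Complex.I * (⟪z, x⟫ : ℂ)) ∂μ =
    Complex.exp (- charExp1 d Λ z)

/-- `μ` is nondegenerate: its support is not contained in any proper affine subspace. -/
def Nondegenerate (d : ℕ) (μ : Measure (Ed d)) : Prop :=
  ∀ (a : Ed d) (W : Submodule ℝ (Ed d)), W ≠ ⊤ →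
    μ ((fun x => a + x) '' (W : Set (Ed d))) < 1

/-- `P` is the restriction to the sphere of a polynomial on `ℝ^d`. -/
def IsPolyRestriction (d : ℕ) (P : Sph d → ℝ) : Prop :=
  ∃ p : MvPolynomial (Fin d) ℝ,
    ∀ u : Sph d, P u = MvPolynomial.eval (fun i => (u : Ed d) i) p

/-- `P` is the restriction to the sphere of a polynomial of degree at most `q`. -/
def IsPolyRestrictionDeg (d q : ℕ) (P : Sph d → ℝ) : Prop :=
  ∃ p : MvPolynomial (Fin d) ℝ, p.totalDegree ≤ q ∧
    ∀ u : Sph d, P u = MvPolynomial.eval (fun i => (u : Ed d) i) p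

/-- `f` is a spherical harmonic of degree `j`: the restriction to the sphere of a
homogeneous harmonic polynomial of degree `j`. -/
def IsSphericalHarmonicC (d j : ℕ) (f : Sph d → ℂ) : Prop :=
  ∃ p : MvPolynomial (Fin d) ℂ, p.IsHomogeneous j ∧
    (∑ i : Fin d, MvPolynomial.pderiv i (MvPolynomial.pderiv i p)) = 0 ∧
    ∀ u : Sph d, f u = MvPolynomial.eval (fun i => ((u : Ed d) i : ℂ)) p

/-- `S_{j,k} = (-i)^j proj_j (V^k)`. -/
def SHk (d : ℕ) (α : ℝ) (Λ : Measure (Sph d)) (j k : ℕ) (u : Sph d) : ℂ :=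
  (-Complex.I) ^ j * projC d j (fun v => (Vfun d α Λ v) ^ k) u

/-- `S_{j,p} = (-i)^j proj_j (V^p)` for real exponents `p` (principal branch). -/
def SHp (d : ℕ) (α : ℝ) (Λ : Measure (Sph d)) (j : ℕ) (p : ℝ) (u : Sph d) : ℂ :=
  (-Complex.I) ^ j * projC d j (fun v => (Vfun d α Λ v) ^ (p : ℂ)) u

/-- `g` is the density of the stable distribution with characteristic exponent
`charExp d α Λ`, given by the Fourier inversion formula. -/
def IsDensityOf (d : ℕ) (α : ℝ) (Λ : Measure (Sph d)) (g : Ed d → ℝ) : Prop :=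
  ∀ x : Ed d, (g x : ℂ) =
    (((2 * Real.pi) ^ d)⁻¹ : ℝ) *
      ∫ z : Ed d, Complex.exp (-(Complex.I * (⟪x, z⟫ : ℂ))) *
        Complex.exp (- charExp d α Λ z)

/-- Harmonic numbers `s_n`. -/
def harmonicNum (n : ℕ) : ℝ := ∑ i ∈ Finset.range n, (1 : ℝ) / (i + 1)

def betaD (d : ℕ) : ℝ :=
  if Even d then 1 - Real.log 2 - harmonicNum (d / 2) / 2
  else 1 - harmonicNum (d + 1) + harmonicNum ((d + 1) / 2) / 2

/-- The coefficients `w*_j` (for odd `j`). -/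
def wstar (d j : ℕ) : ℝ :=
  if j = 1 then Real.pi ^ ((d : ℝ) / 2) * betaD d / Real.Gamma ((d : ℝ) / 2 + 1)
  else (-1 : ℝ) ^ ((j - 3) / 2) * Real.pi ^ ((d : ℝ) / 2) *
      Real.Gamma (((j : ℝ) - 1) / 2) / (2 * Real.Gamma (((d : ℝ) + 1 + j) / 2))

/-- The Bessel function of the first kind `J_τ`. -/
def besselJ (τ : ℝ) (x : ℝ) : ℝ :=
  ∑' k : ℕ, (-1 : ℝ) ^ k * (x / 2) ^ (2 * (k : ℝ) + τ) /
    ((Nat.factorial k : ℝ) * Real.Gamma ((k : ℝ) + τ + 1))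

/-- The `(j,k)`-term `((-2^α)^k π^{-d/2} / (k! ρ^{kα+d})) (Γ((j+kα+d)/2)/Γ((j-kα)/2)) S_{j,k}(u)`
of the spherical-harmonic series for the density (`α ∈ (0,1)`), at radius `ρ`. -/
def phiTerm (d : ℕ) (α : ℝ) (Λ : Measure (Sph d)) (j k : ℕ) (ρ : ℝ) (u : Sph d) : ℂ :=
  ((((-((2 : ℝ) ^ α)) ^ k * Real.pi ^ (-(d : ℝ) / 2) /
      ((Nat.factorial k : ℝ) * ρ ^ ((k : ℝ) * α + d)) *
      (Real.Gamma (((j : ℝ) + k * α + d) / 2) /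
        Real.Gamma (((j : ℝ) - k * α) / 2))) : ℝ) : ℂ) * SHk d α Λ j k u

/-- The `k`-th term `((-2^α)^k π^{-d/2} / (k! r^{kα+1})) (Γ((kα+d)/2)/Γ(-kα/2)) ∫ V^k dω`
of the series for the density of `|X|`. -/
def radTerm (d : ℕ) (α : ℝ) (Λ : Measure (Sph d)) (k : ℕ) (r : ℝ) : ℂ :=
  ((((-((2 : ℝ) ^ α)) ^ k * Real.pi ^ (-(d : ℝ) / 2) /
      ((Nat.factorial k : ℝ) * r ^ ((k : ℝ) * α + 1)) *
      (Real.Gamma (((k : ℝ) * α + d) / 2) / Real.Gamma (-((k : ℝ) * α) / 2))) : ℝ) : ℂ) *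
    ∫ u, (Vfun d α Λ u) ^ k ∂(ωd d)

end StablePaper

namespace StablePaper


/-- The norm of `t ^ q * exp (-w t ^ p)` for `t > 0`. -/
theorem norm_rpow_mul_cexp {p q t : ℝ} (w : ℂ) (ht : 0 < t) :
    ‖((t ^ q : ℝ) : ℂ) * Complex.exp (-w * ((t ^ p : ℝ) : ℂ))‖ =
      t ^ q * Real.exp (-w.re * t ^ p) := by
  rw [norm_mul, Complex.norm_real, Complex.norm_exp, Complex.re_mul_ofReal, Complex.neg_re,
    Real.norm_of_nonneg (Real.rpow_nonneg ht.le _)]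

theorem measurable_rpow_mul_cexp (p q : ℝ) (w : ℂ) :
    Measurable fun t : ℝ => ((t ^ q : ℝ) : ℂ) * Complex.exp (-w * ((t ^ p : ℝ) : ℂ)) := by
  fun_prop

theorem integrableOn_rpow_mul_cexp {p q : ℝ} (hp : 0 < p) (hq : -1 < q) {w : ℂ}
    (hw : 0 < w.re) :
    IntegrableOn (fun t : ℝ => ((t ^ q : ℝ) : ℂ) * Complex.exp (-w * ((t ^ p : ℝ) : ℂ)))
      (Set.Ioi 0) := by
  refine (integrableOn_rpow_mul_exp_neg_mul_rpow hq hp hw).mono'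
    (measurable_rpow_mul_cexp p q w).aestronglyMeasurable ?_
  filter_upwards [ae_restrict_mem measurableSet_Ioi] with t ht
  rw [norm_rpow_mul_cexp w ht]

theorem differentiableAt_integral_rpow_mul_cexp {p q : ℝ} (hp : 0 < p) (hq : -1 < q) {w : ℂ}
    (hw : 0 < w.re) :
    DifferentiableAt ℂ (fun z : ℂ => ∫ t in Set.Ioi (0 : ℝ),
      ((t ^ q : ℝ) : ℂ) * Complex.exp (-z * ((t ^ p : ℝ) : ℂ))) w := by
  have hs : {z : ℂ | w.re / 2 < z.re} ∈ 𝓝 w :=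
    (isOpen_lt continuous_const Complex.continuous_re).mem_nhds (by simpa using hw)
  refine (hasDerivAt_integral_of_dominated_loc_of_deriv_le
    (μ := volume.restrict (Set.Ioi 0))
    (F := fun z t => ((t ^ q : ℝ) : ℂ) * Complex.exp (-z * ((t ^ p : ℝ) : ℂ)))
    (bound := fun t : ℝ => t ^ (q + p) * Real.exp (-(w.re / 2) * t ^ p))
    (F' := fun z t => -(((t ^ (q + p) : ℝ) : ℂ) * Complex.exp (-z * ((t ^ p : ℝ) : ℂ))))
    hs ?_ (integrableOn_rpow_mul_cexp hp hq hw) ?_ ?_ ?_ ?_).2.differentiableAt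
  · exact .of_forall fun z => (measurable_rpow_mul_cexp p q z).aestronglyMeasurable
  · exact (measurable_rpow_mul_cexp p (q + p) w).neg.aestronglyMeasurable
  · filter_upwards [ae_restrict_mem measurableSet_Ioi] with t ht z hz
    have ht' : 0 < t := ht
    rw [norm_neg, norm_rpow_mul_cexp z ht']
    have hz' : w.re / 2 < z.re := hz
    gcongr
  · exact integrableOn_rpow_mul_exp_neg_mul_rpow (by linarith) hp (by linarith)
  · filter_upwards [ae_restrict_mem measurableSet_Ioi] with t ht z hz
    have ht' : 0 < t := ht
    have h1 : HasDerivAt (fun z : ℂ => -z * ((t ^ p : ℝ) : ℂ)) (-1 * ((t ^ p : ℝ) : ℂ)) z :=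
      (hasDerivAt_neg z).mul_const _
    refine (h1.cexp.const_mul ((t ^ q : ℝ) : ℂ)).congr_deriv ?_
    rw [Real.rpow_add ht']
    push_cast
    ring

/-- Gamma-type integral with a complex rate in the right half-plane. -/
theorem integral_rpow_mul_cexp {p q : ℝ} (hp : 0 < p) (hq : -1 < q) {w : ℂ}
    (hw : 0 < w.re) :
    ∫ t in Set.Ioi (0 : ℝ), ((t ^ q : ℝ) : ℂ) * Complex.exp (-w * ((t ^ p : ℝ) : ℂ)) =
      w ^ ((-((q + 1) / p) : ℝ) : ℂ) * ((1 / p * Real.Gamma ((q + 1) / p) : ℝ) : ℂ) := by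
  have hopen : IsOpen {z : ℂ | 0 < z.re} := isOpen_lt continuous_const Complex.continuous_re
  have hconv : Convex ℝ {z : ℂ | 0 < z.re} := convex_halfSpace_re_gt 0
  have hf : AnalyticOnNhd ℂ (fun z : ℂ => ∫ t in Set.Ioi (0 : ℝ),
      ((t ^ q : ℝ) : ℂ) * Complex.exp (-z * ((t ^ p : ℝ) : ℂ))) {z : ℂ | 0 < z.re} :=
    DifferentiableOn.analyticOnNhd (fun z hz =>
      (differentiableAt_integral_rpow_mul_cexp hp hq hz).differentiableWithinAt) hopen
  have hg : AnalyticOnNhd ℂ (fun z : ℂ => z ^ ((-((q + 1) / p) : ℝ) : ℂ) *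
      ((1 / p * Real.Gamma ((q + 1) / p) : ℝ) : ℂ)) {z : ℂ | 0 < z.re} := by
    refine DifferentiableOn.analyticOnNhd (fun z hz => ?_) hopen
    exact ((differentiableAt_id.cpow_const (Or.inl hz)).mul_const _).differentiableWithinAt
  have hreal : ∀ b : ℝ, 0 < b → ∫ t in Set.Ioi (0 : ℝ),
      ((t ^ q : ℝ) : ℂ) * Complex.exp (-(b : ℂ) * ((t ^ p : ℝ) : ℂ)) =
      (b : ℂ) ^ ((-((q + 1) / p) : ℝ) : ℂ) * ((1 / p * Real.Gamma ((q + 1) / p) : ℝ) : ℂ) := by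
    intro b hb
    rw [← Complex.ofReal_cpow hb.le, ← Complex.ofReal_mul, ← mul_assoc, ← neg_div,
      ← integral_rpow_mul_exp_neg_mul_rpow hp hq hb, ← integral_complex_ofReal]
    refine integral_congr_ae (.of_forall fun t => ?_)
    push_cast
    rfl
  have hfreq : ∃ᶠ z in 𝓝[≠] (1 : ℂ), ∫ t in Set.Ioi (0 : ℝ),
      ((t ^ q : ℝ) : ℂ) * Complex.exp (-z * ((t ^ p : ℝ) : ℂ)) =
      z ^ ((-((q + 1) / p) : ℝ) : ℂ) * ((1 / p * Real.Gamma ((q + 1) / p) : ℝ) : ℂ) := by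
    have ht : Tendsto (fun b : ℝ => (b : ℂ)) (𝓝[>] 1) (𝓝[≠] (1 : ℂ)) := by
      refine tendsto_nhdsWithin_of_tendsto_nhds_of_eventually_within _ ?_ ?_
      · exact (Complex.continuous_ofReal.tendsto' 1 1 (by simp)).mono_left nhdsWithin_le_nhds
      · filter_upwards [self_mem_nhdsWithin] with b hb
        have : (1 : ℝ) < b := hb
        simpa using this.ne'
    refine ht.frequently (Eventually.frequently ?_)
    filter_upwards [self_mem_nhdsWithin] with b hb
    exact hreal b (zero_lt_one.trans hb)
  exact hf.eqOn_of_preconnected_of_frequently_eq hg hconv.isPreconnected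
    (show (1 : ℂ) ∈ {z : ℂ | 0 < z.re} by simp) hfreq hw
section Gegenbauer

theorem risingFactorial_succ (b : ℝ) (n : ℕ) :
    risingFactorial b (n + 1) = risingFactorial b n * (b + n) :=
  Finset.prod_range_succ _ _

theorem risingFactorial_zero (b : ℝ) : risingFactorial b 0 = 1 :=
  Finset.prod_range_zero _

theorem risingFactorial_pos {b : ℝ} (hb : 0 < b) (n : ℕ) : 0 < risingFactorial b n :=
  Finset.prod_pos fun _ _ => by positivity

theorem Gamma_add_nat {b : ℝ} (hb : 0 < b) (n : ℕ) :
    Real.Gamma (b + n) = risingFactorial b n * Real.Gamma b := by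
  induction n with
  | zero => simp [risingFactorial_zero]
  | succ n ih =>
    rw [Nat.cast_succ, ← add_assoc, Real.Gamma_add_one (by positivity), ih, risingFactorial_succ]
    ring

/-- Summation over `2 * m ≤ k`, extended by zero to any larger range. -/
theorem sum_range_half_eq {M : Type*} [AddCommMonoid M] (f : ℕ → M) {k N : ℕ} (hN : k < N) :
    ∑ m ∈ Finset.range (k / 2 + 1), f m =
      ∑ m ∈ Finset.range N, if 2 * m ≤ k then f m else 0 := by
  rw [← Finset.sum_filter]
  refine Finset.sum_congr ?_ fun _ _ => rfl
  ext m
  simp only [Finset.mem_range, Finset.mem_filter]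
  omega

/-- The `m`-th term of the explicit sum for the Gegenbauer polynomial. -/
def gegenbauerTerm (b t : ℝ) (j m : ℕ) : ℝ :=
  if 2 * m ≤ j then (-1 : ℝ) ^ m * 2 ^ (j - 2 * m) * risingFactorial b (j - m) /
      ((Nat.factorial m : ℝ) * (Nat.factorial (j - 2 * m) : ℝ)) * t ^ (j - 2 * m) else 0

theorem gegenbauer_eq_sum (b t : ℝ) {j N : ℕ} (hN : j < N) :
    gegenbauer b j t = ∑ m ∈ Finset.range N, gegenbauerTerm b t j m :=
  sum_range_half_eq _ hN

theorem gegenbauerTerm_zero_rec (b t : ℝ) (j : ℕ) :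
    ((j : ℝ) + 2) * gegenbauerTerm b t (j + 2) 0 =
      2 * (j + 1 + b) * t * gegenbauerTerm b t (j + 1) 0 := by
  simp only [gegenbauerTerm, mul_zero, Nat.zero_le, if_true, Nat.sub_zero,
    risingFactorial_succ b (j + 1), Nat.factorial_succ (j + 1)]
  have := Nat.factorial_pos (j + 1)
  push_cast
  field_simp
  ring

theorem gegenbauerTerm_succ_rec (b t : ℝ) (j m : ℕ) :
    ((j : ℝ) + 2) * gegenbauerTerm b t (j + 2) (m + 1) =
      2 * (j + 1 + b) * t * gegenbauerTerm b t (j + 1) (m + 1) -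
        (j + 2 * b) * gegenbauerTerm b t j m := by
  rcases lt_or_ge j (2 * m) with h | h
  · simp [gegenbauerTerm, show ¬ 2 * (m + 1) ≤ j + 2 by omega,
      show ¬ 2 * (m + 1) ≤ j + 1 by omega, show ¬ 2 * m ≤ j by omega]
  obtain ⟨i, rfl⟩ := Nat.exists_eq_add_of_le h
  rcases i with _ | i
  · simp only [gegenbauerTerm, add_zero, show 2 * (m + 1) ≤ 2 * m + 2 by omega,
      show ¬ 2 * (m + 1) ≤ 2 * m + 1 by omega, le_refl, if_true, if_false,
      show 2 * m + 2 - 2 * (m + 1) = 0 by omega, show 2 * m + 2 - (m + 1) = m + 1 by omega,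
      Nat.sub_self, show 2 * m - m = m by omega, risingFactorial_succ, Nat.factorial_succ]
    push_cast
    field_simp
    ring
  · simp only [gegenbauerTerm, show 2 * (m + 1) ≤ 2 * m + (i + 1) + 2 by omega,
      show 2 * (m + 1) ≤ 2 * m + (i + 1) + 1 by omega, show 2 * m ≤ 2 * m + (i + 1) by omega,
      if_true, show 2 * m + (i + 1) + 2 - 2 * (m + 1) = i + 1 by omega,
      show 2 * m + (i + 1) + 1 - 2 * (m + 1) = i by omega,
      show 2 * m + (i + 1) + 2 - (m + 1) = m + i + 1 + 1 by omega,
      show 2 * m + (i + 1) + 1 - (m + 1) = m + i + 1 by omega,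
      show 2 * m + (i + 1) - 2 * m = i + 1 by omega,
      show 2 * m + (i + 1) - m = m + i + 1 by omega, risingFactorial_succ b (m + i + 1),
      Nat.factorial_succ]
    push_cast
    field_simp
    ring

/-- The three-term recurrence of the Gegenbauer polynomials. -/
theorem gegenbauer_rec (b t : ℝ) (j : ℕ) :
    ((j : ℝ) + 2) * gegenbauer b (j + 2) t =
      2 * (j + 1 + b) * t * gegenbauer b (j + 1) t - (j + 2 * b) * gegenbauer b j t := by
  rw [gegenbauer_eq_sum b t (show j + 2 < j + 2 + 1 by omega),
    gegenbauer_eq_sum b t (show j + 1 < j + 2 + 1 by omega),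
    gegenbauer_eq_sum b t (show j < j + 2 by omega),
    Finset.sum_range_succ' (gegenbauerTerm b t (j + 2)),
    Finset.sum_range_succ' (gegenbauerTerm b t (j + 1)), mul_add, mul_add,
    gegenbauerTerm_zero_rec, Finset.mul_sum, Finset.mul_sum, Finset.mul_sum,
    add_sub_right_comm, ← Finset.sum_sub_distrib]
  simp_rw [gegenbauerTerm_succ_rec]

theorem gegenbauer_zero (b t : ℝ) : gegenbauer b 0 t = 1 := by
  simp [gegenbauer, risingFactorial_zero]

theorem gegenbauer_one (b t : ℝ) : gegenbauer b 1 t = 2 * b * t := by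
  simp [gegenbauer, risingFactorial]

theorem gegenbauer_at_one (b : ℝ) (j : ℕ) :
    gegenbauer b j 1 = risingFactorial (2 * b) j / (Nat.factorial j : ℝ) := by
  induction j using Nat.twoStepInduction with
  | zero => simp [gegenbauer_zero, risingFactorial_zero]
  | one => simp [gegenbauer_one, risingFactorial]
  | more j h0 h1 =>
    have h := gegenbauer_rec b 1 j
    rw [h0, h1, risingFactorial_succ] at h
    have h2 : (j : ℝ) + 2 ≠ 0 := by positivity
    rw [← mul_right_inj' h2, h]
    simp only [risingFactorial_succ, Nat.factorial_succ]
    push_cast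
    field_simp
    ring

theorem continuous_gegenbauerN (b : ℝ) (j : ℕ) : Continuous (gegenbauerN b j) := by
  unfold gegenbauerN
  split_ifs
  · exact Polynomial.continuous _
  · unfold gegenbauer
    fun_prop

theorem risingFactorial_nat (e n : ℕ) :
    risingFactorial ((e : ℝ) + 1) n = (Nat.factorial (e + n) : ℝ) / (Nat.factorial e : ℝ) := by
  induction n with
  | zero => simp [risingFactorial_zero, (Nat.factorial_pos e).ne']
  | succ n ih =>
    rw [risingFactorial_succ, ih, ← add_assoc, Nat.factorial_succ]
    push_cast
    ring

theorem cdim_add_three (e j : ℕ) :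
    (cdim (e + 3) j : ℝ) =
      (j + ((e : ℝ) + 1) / 2) / (((e : ℝ) + 1) / 2) *
        (risingFactorial ((e : ℝ) + 1) j / (Nat.factorial j : ℝ)) := by
  rcases j with _ | j
  · have : (e : ℝ) + 1 ≠ 0 := by positivity
    simp [cdim, risingFactorial_zero, this]
  · have h1 : j + 1 + (e + 3) - 2 = (j + 1) + (e + 1) := by omega
    have h2 : j + 1 + (e + 3) - 3 = j + (e + 1) := by omega
    rw [cdim, if_neg (Nat.succ_ne_zero j), h1, h2, Nat.add_sub_cancel, Nat.cast_add,
      Nat.cast_add_choose, Nat.cast_add_choose, risingFactorial_nat,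
      show j + 1 + (e + 1) = (e + (j + 1)) + 1 by omega,
      show j + (e + 1) = e + (j + 1) by omega, Nat.factorial_succ (e + (j + 1)),
      Nat.factorial_succ e, Nat.factorial_succ j]
    push_cast
    field_simp
    ring

/-- Zonal harmonics of degree `j`, normalized so that the value at `1` is `dim ℋ_{j,d}`. -/
def zonal (d : ℕ) (t : ℝ) (j : ℕ) : ℝ := (cdim d j : ℝ) * gegenbauerN (((d : ℝ) - 2) / 2) j t

theorem zonal_add_three (e : ℕ) (t : ℝ) (j : ℕ) :
    zonal (e + 3) t j =
      (j + ((e : ℝ) + 1) / 2) / (((e : ℝ) + 1) / 2) * gegenbauer (((e : ℝ) + 1) / 2) j t := by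
  have hb : (((e + 3 : ℕ) : ℝ) - 2) / 2 = ((e : ℝ) + 1) / 2 := by push_cast; ring
  have hpos : 0 < (e : ℝ) + 1 := by positivity
  have hr := (risingFactorial_pos hpos j).ne'
  have hf : (Nat.factorial j : ℝ) ≠ 0 := by positivity
  rw [zonal, hb, gegenbauerN, if_neg (by positivity), gegenbauer_at_one, cdim_add_three,
    mul_div_cancel₀ _ (two_ne_zero' ℝ)]
  field_simp

theorem zonal_two_zero (t : ℝ) : zonal 2 t 0 = 1 := by
  simp [zonal, cdim, gegenbauerN]

theorem zonal_two_succ (t : ℝ) (j : ℕ) :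
    zonal 2 t (j + 1) = 2 * (Polynomial.Chebyshev.T ℝ ((j : ℤ) + 1)).eval t := by
  simp [zonal, cdim, gegenbauerN]

theorem zonal_zero {d : ℕ} (hd : 2 ≤ d) (t : ℝ) : zonal d t 0 = 1 := by
  rcases hd.eq_or_lt with rfl | h
  · exact zonal_two_zero t
  · obtain ⟨e, rfl⟩ := Nat.exists_eq_add_of_le' (show 3 ≤ d from h)
    have : (e : ℝ) + 1 ≠ 0 := by positivity
    simp [zonal_add_three, gegenbauer_zero, this]

theorem zonal_one {d : ℕ} (hd : 2 ≤ d) (t : ℝ) : zonal d t 1 = d * t := by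
  rcases hd.eq_or_lt with rfl | h
  · simpa using zonal_two_succ t 0
  · obtain ⟨e, rfl⟩ := Nat.exists_eq_add_of_le' (show 3 ≤ d from h)
    rw [zonal_add_three, gegenbauer_one]
    push_cast
    field_simp
    ring

theorem zonal_rec_one {d : ℕ} (hd : 2 ≤ d) (t : ℝ) :
    2 * t * zonal d t 1 =
      2 / (2 + ((d : ℝ) - 2) / 2) * zonal d t 2 + 2 * zonal d t 0 := by
  rcases hd.eq_or_lt with rfl | h
  · rw [zonal_one le_rfl, zonal_zero le_rfl, zonal_two_succ t 1]
    simp [Polynomial.Chebyshev.T_two, one_add_one_eq_two]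
    ring
  · obtain ⟨e, rfl⟩ := Nat.exists_eq_add_of_le' (show 3 ≤ d from h)
    have hg := gegenbauer_rec (((e : ℝ) + 1) / 2) t 0
    rw [gegenbauer_one, gegenbauer_zero] at hg
    rw [zonal_one hd, zonal_zero hd, zonal_add_three]
    have hg' : gegenbauer (((e : ℝ) + 1) / 2) 2 t = ((e : ℝ) + 1) / 2 * (t ^ 2 * (e + 3) - 1) := by
      push_cast at hg
      linear_combination hg / 2
    rw [hg']
    push_cast
    have h1 : (e : ℝ) + 1 ≠ 0 := by positivity
    have h2 : (e : ℝ) + 5 ≠ 0 := by positivity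
    have h3 : 2 + ((e : ℝ) + 3 - 2) / 2 = ((e : ℝ) + 5) / 2 := by ring
    rw [h3]
    field_simp
    ring

theorem zonal_rec {d : ℕ} (hd : 2 ≤ d) (t : ℝ) (j : ℕ) :
    2 * t * zonal d t (j + 2) =
      (j + 3) / (j + 3 + ((d : ℝ) - 2) / 2) * zonal d t (j + 3) +
        (j + 1 + 2 * (((d : ℝ) - 2) / 2)) / (j + 1 + ((d : ℝ) - 2) / 2) * zonal d t (j + 1) := by
  rcases hd.eq_or_lt with rfl | h
  · rw [zonal_two_succ t (j + 1), zonal_two_succ t (j + 2), zonal_two_succ t j]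
    have hT := congrArg (Polynomial.eval t) (Polynomial.Chebyshev.T_add_two ℝ ((j : ℤ) + 1))
    simp only [Polynomial.eval_sub, Polynomial.eval_mul, Polynomial.eval_X,
      Polynomial.eval_ofNat] at hT
    push_cast
    rw [show (j : ℤ) + 2 + 1 = j + 1 + 2 by ring, hT, sub_self, zero_div, mul_zero, add_zero,
      add_zero, div_self (by positivity), div_self (by positivity)]
    ring
  · obtain ⟨e, rfl⟩ := Nat.exists_eq_add_of_le' (show 3 ≤ d from h)
    have hg := gegenbauer_rec (((e : ℝ) + 1) / 2) t (j + 1)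
    rw [zonal_add_three, zonal_add_three, zonal_add_three]
    have hg' : gegenbauer (((e : ℝ) + 1) / 2) (j + 1 + 2) t =
        ((2 * j + e + 5) * t * gegenbauer (((e : ℝ) + 1) / 2) (j + 2) t -
          (j + e + 2) * gegenbauer (((e : ℝ) + 1) / 2) (j + 1) t) / (j + 3) := by
      rw [eq_div_iff (by positivity)]
      push_cast at hg
      linear_combination hg
    rw [show j + 3 = j + 1 + 2 by ring, hg']
    push_cast
    have h1 : (e : ℝ) + 1 ≠ 0 := by positivity
    have h2 : 2 * (j : ℝ) + e + 7 ≠ 0 := by positivity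
    have h3 : 2 * (j : ℝ) + e + 3 ≠ 0 := by positivity
    have h4 : (j : ℝ) + 3 ≠ 0 := by positivity
    have e1 : (j : ℝ) + 3 + ((e : ℝ) + 3 - 2) / 2 = (2 * j + e + 7) / 2 := by ring
    have e2 : (j : ℝ) + 1 + ((e : ℝ) + 3 - 2) / 2 = (2 * j + e + 3) / 2 := by ring
    have e3 : (j : ℝ) + 1 + 2 + ((e : ℝ) + 1) / 2 = (2 * j + e + 7) / 2 := by ring
    have e4 : (j : ℝ) + 1 + ((e : ℝ) + 1) / 2 = (2 * j + e + 3) / 2 := by ring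
    rw [e1, e2, e3, e4]
    field_simp
    ring

/-- The `m`-th term in the zonal expansion of `(2 t) ^ k / k!`. -/
def zonalTerm (d : ℕ) (t : ℝ) (k m : ℕ) : ℝ :=
  if 2 * m ≤ k then
    zonal d t (k - 2 * m) / ((Nat.factorial m : ℝ) * risingFactorial ((d : ℝ) / 2) (k - m))
  else 0

/-- The part of `2 t * zonalTerm d t k m` that raises the degree of the zonal harmonic. -/
def zonalTermUp (d : ℕ) (t : ℝ) (k m : ℕ) : ℝ :=
  if 2 * m ≤ k then
    (((k - 2 * m : ℕ) : ℝ) + 1) / (((k - 2 * m : ℕ) : ℝ) + 1 + ((d : ℝ) - 2) / 2) *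
      zonal d t (k - 2 * m + 1) /
        ((Nat.factorial m : ℝ) * risingFactorial ((d : ℝ) / 2) (k - m))
  else 0

theorem zonalTerm_zero_eq {d : ℕ} (hd : 2 ≤ d) (t : ℝ) (k : ℕ) :
    ((k : ℝ) + 1) * zonalTerm d t (k + 1) 0 = zonalTermUp d t k 0 := by
  have hd' : (2 : ℝ) ≤ d := by exact_mod_cast hd
  have hr := (risingFactorial_pos (b := (d : ℝ) / 2) (by linarith) k).ne'
  have h1 : (k : ℝ) + 1 + ((d : ℝ) - 2) / 2 = (d : ℝ) / 2 + k := by ring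
  have h2 : (d : ℝ) / 2 + k ≠ 0 := by positivity
  simp only [zonalTerm, zonalTermUp, mul_zero, Nat.zero_le, if_true, Nat.sub_zero, h1,
    risingFactorial_succ, Nat.factorial_zero, Nat.cast_one, one_mul]
  field_simp

theorem zonalTerm_succ_eq {d : ℕ} (hd : 2 ≤ d) (t : ℝ) (k m : ℕ) :
    ((k : ℝ) + 1) * zonalTerm d t (k + 1) (m + 1) =
      zonalTermUp d t k (m + 1) + (2 * t * zonalTerm d t k m - zonalTermUp d t k m) := by
  have hd' : (2 : ℝ) ≤ d := by exact_mod_cast hd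
  have hd0 : 0 < (d : ℝ) / 2 := by linarith
  rcases lt_or_ge k (2 * m) with h | h
  · simp [zonalTerm, zonalTermUp, show ¬ 2 * (m + 1) ≤ k + 1 by omega,
      show ¬ 2 * (m + 1) ≤ k by omega, show ¬ 2 * m ≤ k by omega]
  obtain ⟨i, rfl⟩ := Nat.exists_eq_add_of_le h
  have hm : (Nat.factorial m : ℝ) ≠ 0 := by positivity
  rcases i with _ | _ | i
  · have h1 : 0 + 1 + ((d : ℝ) - 2) / 2 = (d : ℝ) / 2 := by ring
    have hr := (risingFactorial_pos hd0 m).ne'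
    simp only [zonalTerm, zonalTermUp, add_zero, show ¬ 2 * (m + 1) ≤ 2 * m by omega,
      show ¬ 2 * (m + 1) ≤ 2 * m + 1 by omega, le_refl, if_true, if_false, Nat.sub_self,
      show 2 * m - m = m by omega, zonal_zero hd, zonal_one hd, zero_add, Nat.cast_zero]
    rw [zero_add] at h1
    rw [h1]
    field_simp
    ring
  · have hz := zonal_rec_one hd t
    rw [zonal_zero hd] at hz
    have hr := (risingFactorial_pos hd0 (m + 1)).ne'
    simp only [zonalTerm, zonalTermUp, show ¬ 2 * (m + 1) ≤ 2 * m + (0 + 1) by omega,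
      show 2 * (m + 1) ≤ 2 * m + (0 + 1) + 1 by omega,
      show 2 * m ≤ 2 * m + (0 + 1) by omega, if_true, if_false,
      show 2 * m + (0 + 1) + 1 - 2 * (m + 1) = 0 by omega,
      show 2 * m + (0 + 1) + 1 - (m + 1) = m + 1 by omega,
      show 2 * m + (0 + 1) - 2 * m = 1 by omega,
      show 2 * m + (0 + 1) - m = m + 1 by omega, zonal_zero hd, Nat.factorial_succ]
    rw [← mul_div_assoc (2 * t), hz]
    push_cast
    rw [one_add_one_eq_two]
    field_simp
    ring
  · have hz := zonal_rec hd t i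
    have hr := (risingFactorial_pos hd0 (m + i + 2)).ne'
    have hm1 : 2 * (m + 1) ≤ 2 * m + (i + 1 + 1) := by omega
    simp only [zonalTerm, zonalTermUp, hm1,
      show 2 * (m + 1) ≤ 2 * m + (i + 1 + 1) + 1 by omega,
      show 2 * m ≤ 2 * m + (i + 1 + 1) by omega, if_true,
      show 2 * m + (i + 1 + 1) + 1 - 2 * (m + 1) = i + 1 by omega,
      show 2 * m + (i + 1 + 1) + 1 - (m + 1) = m + i + 2 by omega,
      show 2 * m + (i + 1 + 1) - 2 * (m + 1) = i by omega,
      show 2 * m + (i + 1 + 1) - (m + 1) = m + i + 1 by omega,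
      show 2 * m + (i + 1 + 1) - 2 * m = i + 2 by omega,
      show 2 * m + (i + 1 + 1) - m = m + i + 2 by omega, Nat.factorial_succ]
    have hs : risingFactorial ((d : ℝ) / 2) (m + i + 2) =
        risingFactorial ((d : ℝ) / 2) (m + i + 1) * ((d : ℝ) / 2 + (m + i + 1)) := by
      rw [risingFactorial_succ]
      push_cast
      ring
    have hr' := (risingFactorial_pos hd0 (m + i + 1)).ne'
    have hq : (d : ℝ) / 2 + (m + i + 1) ≠ 0 := by positivity
    have hl : (i : ℝ) + 1 + ((d : ℝ) - 2) / 2 ≠ 0 := by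
      have : (i : ℝ) + 1 + ((d : ℝ) - 2) / 2 = i + (d : ℝ) / 2 := by ring
      rw [this]
      positivity
    rw [← mul_div_assoc (2 * t), hz, hs]
    push_cast
    rw [show (i : ℝ) + 2 + 1 = i + 3 by ring, ← sub_div, add_sub_cancel_left]
    generalize zonal d t (i + 1) = Z
    generalize risingFactorial ((d : ℝ) / 2) (m + i + 1) = R at *
    obtain ⟨l, hl'⟩ : ∃ l : ℝ, ((d : ℝ) - 2) / 2 = l := ⟨_, rfl⟩
    have hdl : (d : ℝ) / 2 = l + 1 := by linarith
    rw [hdl] at hq ⊢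
    rw [hl'] at hl ⊢
    field_simp
    ring

/-- Expansion of a power into zonal harmonics. -/
theorem two_mul_pow_eq_sum_zonalTerm {d : ℕ} (hd : 2 ≤ d) (t : ℝ) (k : ℕ) :
    (2 * t) ^ k / (Nat.factorial k : ℝ) = ∑ m ∈ Finset.range (k + 1), zonalTerm d t k m := by
  induction k with
  | zero => simp [zonalTerm, zonal_zero hd, risingFactorial_zero]
  | succ k ih =>
    have hk : (k : ℝ) + 1 ≠ 0 := by positivity
    have htop : zonalTermUp d t k (k + 1) = 0 :=
      if_neg (by omega)
    rw [← mul_right_inj' hk, Finset.sum_range_succ', mul_add, zonalTerm_zero_eq hd,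
      Finset.mul_sum]
    simp_rw [zonalTerm_succ_eq hd]
    have hshift := Finset.sum_range_succ' (zonalTermUp d t k) (k + 1)
    rw [Finset.sum_range_succ, htop, add_zero] at hshift
    rw [Finset.sum_add_distrib, Finset.sum_sub_distrib, ← Finset.mul_sum, ← ih, hshift,
      Nat.factorial_succ]
    push_cast
    field_simp
    ring

theorem pow_div_factorial_eq_sum_zonal {d : ℕ} (hd : 2 ≤ d) (t : ℝ) (k : ℕ) :
    t ^ k / (Nat.factorial k : ℝ) = Real.Gamma ((d : ℝ) / 2) / 2 ^ k *
      ∑ m ∈ Finset.range (k / 2 + 1),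
        zonal d t (k - 2 * m) /
          ((Nat.factorial m : ℝ) * Real.Gamma ((k : ℝ) - m + (d : ℝ) / 2)) := by
  have hd0 : 0 < (d : ℝ) / 2 := by positivity
  have h := two_mul_pow_eq_sum_zonalTerm hd t k
  rw [show (∑ m ∈ Finset.range (k + 1), zonalTerm d t k m) = _ from
    (sum_range_half_eq _ k.lt_succ_self).symm, mul_pow] at h
  rw [← mul_right_inj' (pow_ne_zero k (two_ne_zero' ℝ)), ← mul_div_assoc, h, ← mul_assoc,
    mul_div_cancel₀ _ (pow_ne_zero k (two_ne_zero' ℝ)), Finset.mul_sum]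
  refine Finset.sum_congr rfl fun m hm => ?_
  have hmk : m ≤ k := by
    have := Finset.mem_range.1 hm
    omega
  have hG := (Real.Gamma_pos_of_pos hd0).ne'
  have hr := (risingFactorial_pos hd0 (k - m)).ne'
  rw [← Nat.cast_sub hmk, add_comm _ ((d : ℝ) / 2), Gamma_add_nat hd0]
  field_simp

end Gegenbauer
section CharacteristicExponent

variable {d : ℕ} {α : ℝ} (Λ : Measure (Sph d))

/-- The integrand of `charExp` as a function of `⟪z, v⟫`. -/
def stableKernel (α t : ℝ) : ℂ :=
  (|t| ^ α : ℝ) * (1 - Complex.I * (Real.tan (Real.pi * α / 2) : ℂ) * (Real.sign t : ℂ))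

theorem charExp_eq (z : Ed d) :
    charExp d α Λ z = ∫ v, stableKernel α ⟪z, (v : Ed d)⟫ ∂Λ := rfl

theorem stableKernel_zero (hα : 0 < α) : stableKernel α 0 = 0 := by
  simp [stableKernel, Real.zero_rpow hα.ne']

theorem stableKernel_re (t : ℝ) : (stableKernel α t).re = |t| ^ α := by
  simp [stableKernel, -Complex.ofReal_tan]

theorem stableKernel_mul {r : ℝ} (hr : 0 < r) (t : ℝ) :
    stableKernel α (r * t) = ((r ^ α : ℝ) : ℂ) * stableKernel α t := by
  have hs : Real.sign (r * t) = Real.sign t := by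
    rcases lt_trichotomy t 0 with ht | rfl | ht
    · rw [Real.sign_of_neg ht, Real.sign_of_neg (mul_neg_of_pos_of_neg hr ht)]
    · rw [mul_zero]
    · rw [Real.sign_of_pos ht, Real.sign_of_pos (mul_pos hr ht)]
  rw [stableKernel, stableKernel, abs_mul, abs_of_pos hr, Real.mul_rpow hr.le (abs_nonneg t), hs]
  push_cast
  ring

theorem continuous_stableKernel (hα : 0 < α) : Continuous (stableKernel α) := by
  have h : stableKernel α = fun t : ℝ =>
      ((max t 0 ^ α : ℝ) : ℂ) * (1 - Complex.I * (Real.tan (Real.pi * α / 2) : ℂ)) +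
      ((max (-t) 0 ^ α : ℝ) : ℂ) * (1 + Complex.I * (Real.tan (Real.pi * α / 2) : ℂ)) := by
    funext t
    rcases lt_trichotomy t 0 with ht | rfl | ht
    · rw [stableKernel, Real.sign_of_neg ht, abs_of_neg ht, max_eq_right ht.le,
        max_eq_left (by linarith), Real.zero_rpow hα.ne']
      push_cast
      ring
    · simp [stableKernel, Real.zero_rpow hα.ne']
    · rw [stableKernel, Real.sign_of_pos ht, abs_of_pos ht, max_eq_left ht.le,
        max_eq_right (by linarith), Real.zero_rpow hα.ne']
      push_cast
      ring
  rw [h]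
  have h1 : Continuous fun t : ℝ => max t 0 ^ α :=
    (continuous_id.max continuous_const).rpow_const fun _ => Or.inr hα.le
  have h2 : Continuous fun t : ℝ => max (-t) 0 ^ α :=
    (continuous_neg.max continuous_const).rpow_const fun _ => Or.inr hα.le
  fun_prop

theorem charExp_smul {r : ℝ} (hr : 0 < r) (z : Ed d) :
    charExp d α Λ (r • z) = ((r ^ α : ℝ) : ℂ) * charExp d α Λ z := by
  simp_rw [charExp_eq, real_inner_smul_left, stableKernel_mul hr]
  exact integral_const_mul _ _

variable [IsFiniteMeasure Λ]

theorem integrable_stableKernel (hα : 0 < α) (z : Ed d) :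
    Integrable (fun v : Sph d => stableKernel α ⟪z, (v : Ed d)⟫) Λ := by
  have hc : Continuous fun v : Sph d => stableKernel α ⟪z, (v : Ed d)⟫ :=
    (continuous_stableKernel hα).comp (by fun_prop)
  exact hc.integrable_of_hasCompactSupport (HasCompactSupport.of_compactSpace _)

theorem continuous_charExp (hα : 0 < α) : Continuous (charExp d α Λ) := by
  have hc : Continuous (Function.uncurry fun (z : Ed d) (v : Sph d) =>
      stableKernel α ⟪z, (v : Ed d)⟫) :=
    (continuous_stableKernel hα).comp (by fun_prop)
  have := continuous_parametric_integral_of_continuous (μ := Λ) hc isCompact_univ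
  rw [show charExp d α Λ = _ from funext (charExp_eq Λ)]
  simpa only [setIntegral_univ] using this

theorem charExp_re (hα : 0 < α) (z : Ed d) :
    (charExp d α Λ z).re = ∫ v : Sph d, |⟪z, (v : Ed d)⟫| ^ α ∂Λ := by
  rw [charExp_eq, ← RCLike.re_eq_complex_re, ← integral_re (integrable_stableKernel Λ hα z)]
  simp only [RCLike.re_eq_complex_re, stableKernel_re]

/-- Nondegeneracy makes the real part of the characteristic exponent positive off `0`. -/
theorem charExp_re_pos (hα : 0 < α) {μ : Measure (Ed d)} [IsProbabilityMeasure μ]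
    (hμ : IsStableChar d α Λ μ) (hnd : Nondegenerate d μ) {z : Ed d} (hz : z ≠ 0) :
    0 < (charExp d α Λ z).re := by
  by_contra hneg
  have hnn : 0 ≤ fun v : Sph d => |⟪z, (v : Ed d)⟫| ^ α := fun v => by positivity
  have hint : Integrable (fun v : Sph d => |⟪z, (v : Ed d)⟫| ^ α) Λ := by
    simpa only [RCLike.re_eq_complex_re, stableKernel_re] using (integrable_stableKernel Λ hα z).re
  have h0 : ∫ v : Sph d, |⟪z, (v : Ed d)⟫| ^ α ∂Λ = 0 :=
    le_antisymm (by rw [← charExp_re Λ hα]; exact not_lt.1 hneg) (integral_nonneg hnn)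
  have hae : ∀ᵐ v : Sph d ∂Λ, ⟪z, (v : Ed d)⟫ = 0 := by
    filter_upwards [(integral_eq_zero_iff_of_nonneg hnn hint).1 h0] with v hv
    have hv' : |⟪z, (v : Ed d)⟫| ^ α = 0 := hv
    rwa [Real.rpow_eq_zero (abs_nonneg _) hα.ne', abs_eq_zero] at hv'
  have hline : ∀ s : ℝ, charExp d α Λ (s • z) = 0 := fun s => by
    rw [charExp_eq]
    refine integral_eq_zero_of_ae ?_
    filter_upwards [hae] with v hv
    rw [real_inner_smul_left, hv, mul_zero, stableKernel_zero hα, Pi.zero_apply]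
  have hmeas : Measurable fun x : Ed d => ⟪z, x⟫ := by fun_prop
  have : IsProbabilityMeasure (μ.map fun x => ⟪z, x⟫) :=
    Measure.isProbabilityMeasure_map hmeas.aemeasurable
  have hmap : μ.map (fun x => ⟪z, x⟫) = Measure.dirac (0 : ℝ) := by
    refine Measure.ext_of_charFun (funext fun s => ?_)
    rw [charFun_apply_real, charFun_dirac, integral_map hmeas.aemeasurable (by fun_prop)]
    have h1 := hμ (s • z)
    rw [hline, neg_zero, Complex.exp_zero] at h1
    simp only [inner_zero_left, Complex.ofReal_zero, zero_mul, Complex.exp_zero]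
    rw [← h1]
    refine integral_congr_ae (.of_forall fun x => ?_)
    simp only [real_inner_smul_left]
    push_cast
    ring_nf
  have hW : (innerSL ℝ z : Ed d →L[ℝ] ℝ).ker ≠ ⊤ := fun htop => by
    have hzk : z ∈ (innerSL ℝ z : Ed d →L[ℝ] ℝ).ker := htop ▸ Submodule.mem_top
    rw [LinearMap.mem_ker] at hzk
    exact hz (inner_self_eq_zero.1 hzk)
  refine (hnd 0 _ hW).ne ?_
  have hset : (fun x : Ed d => 0 + x) '' ((innerSL ℝ z : Ed d →L[ℝ] ℝ).ker : Set (Ed d)) =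
      (fun x : Ed d => ⟪z, x⟫) ⁻¹' {0} := by
    ext x
    simp
  rw [hset, ← Measure.map_apply hmeas (measurableSet_singleton 0), hmap]
  simp

theorem exists_le_charExp_re (hα : 0 < α) (hpos : ∀ z : Ed d, z ≠ 0 → 0 < (charExp d α Λ z).re) :
    ∃ c : ℝ, 0 < c ∧ ∀ z : Ed d, c * ‖z‖ ^ α ≤ (charExp d α Λ z).re := by
  have hcont : Continuous fun z => (charExp d α Λ z).re :=
    Complex.continuous_re.comp (continuous_charExp Λ hα)
  obtain ⟨c, hc, hle⟩ : ∃ c : ℝ, 0 < c ∧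
      ∀ u ∈ Metric.sphere (0 : Ed d) 1, c ≤ (charExp d α Λ u).re := by
    rcases (Metric.sphere (0 : Ed d) 1).eq_empty_or_nonempty with he | hne
    · exact ⟨1, one_pos, by simp [he]⟩
    · obtain ⟨u, hu, hmin⟩ := (isCompact_sphere (0 : Ed d) 1).exists_isMinOn hne hcont.continuousOn
      exact ⟨_, hpos u (ne_zero_of_mem_unit_sphere ⟨u, hu⟩), fun v hv => hmin hv⟩
  refine ⟨c, hc, fun z => ?_⟩
  rcases eq_or_ne z 0 with rfl | hz
  · rw [norm_zero, Real.zero_rpow hα.ne', mul_zero, charExp_re Λ hα]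
    exact integral_nonneg fun v => by positivity
  · have hz' := norm_pos_iff.2 hz
    have hu : ‖z‖⁻¹ • z ∈ Metric.sphere (0 : Ed d) 1 := (unitize z hz).2
    have h1 := charExp_smul (α := α) Λ hz' (‖z‖⁻¹ • z)
    rw [smul_inv_smul₀ hz'.ne'] at h1
    rw [h1, Complex.re_ofReal_mul, mul_comm]
    gcongr
    exact hle _ hu

end CharacteristicExponent
section Moments

instance isFiniteMeasure_ωd (d : ℕ) : IsFiniteMeasure (ωd d) :=
  inferInstanceAs (IsFiniteMeasure (volume : Measure (Ed d)).toSphere)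

/-- Integration in polar coordinates. -/
theorem integral_eq_integral_sphere {d : ℕ} (hd : 1 ≤ d) {f : Ed d → ℂ} (hf : Integrable f) :
    ∫ z, f z = ∫ u : Sph d, (∫ r in Set.Ioi (0 : ℝ),
      ((r ^ (d - 1) : ℝ) : ℂ) * f (r • (u : Ed d))) ∂(ωd d) := by
  have : Nonempty (Fin d) := ⟨⟨0, hd⟩⟩
  have hdim : Module.finrank ℝ (Ed d) = d := by simp
  have hmp := (volume : Measure (Ed d)).measurePreserving_homeomorphUnitSphereProd
  rw [hdim] at hmp
  have hemb := (homeomorphUnitSphereProd (Ed d)).measurableEmbedding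
  have hcomp : ∀ z : ({0}ᶜ : Set (Ed d)),
      f (((homeomorphUnitSphereProd (Ed d) z).2 : ℝ) • ((homeomorphUnitSphereProd (Ed d) z).1 : Ed d)) =
        f z := fun z => by
    have hz : ‖(z : Ed d)‖ ≠ 0 := norm_ne_zero_iff.2 z.2
    simp [smul_inv_smul₀ hz]
  have hint : Integrable (fun p : Sph d × Set.Ioi (0 : ℝ) => f ((p.2 : ℝ) • (p.1 : Ed d)))
      ((ωd d).prod (.volumeIoiPow (d - 1))) := by
    rw [ωd, ← hmp.integrable_comp_emb hemb]
    simp only [Function.comp_def, hcomp]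
    exact (integrableOn_iff_comap_subtypeVal (measurableSet_singleton _).compl).1 hf.integrableOn
  calc
    ∫ z, f z = ∫ z : ({0}ᶜ : Set (Ed d)), f z ∂((volume : Measure (Ed d)).comap (↑)) := by
      rw [integral_subtype_comap (measurableSet_singleton _).compl f,
        restrict_compl_singleton]
    _ = ∫ p : Sph d × Set.Ioi (0 : ℝ), f ((p.2 : ℝ) • (p.1 : Ed d))
          ∂((ωd d).prod (.volumeIoiPow (d - 1))) := by
      rw [ωd, ← hmp.integral_comp hemb]
      simp only [hcomp]
    _ = ∫ u : Sph d, (∫ r : Set.Ioi (0 : ℝ), f ((r : ℝ) • (u : Ed d))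
          ∂(.volumeIoiPow (d - 1))) ∂(ωd d) := integral_prod _ hint
    _ = _ := by
      refine integral_congr_ae (.of_forall fun u => ?_)
      simp only [Measure.volumeIoiPow, ENNReal.ofReal]
      rw [integral_withDensity_eq_integral_smul (measurable_subtype_coe.pow_const _).real_toNNReal,
        integral_subtype_comap measurableSet_Ioi
          fun r => Real.toNNReal (r ^ (d - 1)) • f (r • (u : Ed d))]
      refine setIntegral_congr_fun measurableSet_Ioi fun r hr => ?_
      have hr' : 0 < r := hr
      simp only [NNReal.smul_def, Real.coe_toNNReal _ (pow_nonneg hr'.le _), Complex.real_smul]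

theorem integrable_norm_pow_mul_exp {d : ℕ} (hd : 1 ≤ d) {α c : ℝ} (hα : 0 < α) (hc : 0 < c)
    (k : ℕ) : Integrable fun z : Ed d => ‖z‖ ^ k * Real.exp (-c * ‖z‖ ^ α) := by
  have : Nonempty (Fin d) := ⟨⟨0, hd⟩⟩
  refine (integrable_fun_norm_addHaar (volume : Measure (Ed d))
    (f := fun y : ℝ => y ^ k * Real.exp (-c * y ^ α))).2 ?_
  have hs : (-1 : ℝ) < ((d - 1 + k : ℕ) : ℝ) := by
    have := Nat.cast_nonneg (α := ℝ) (d - 1 + k)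
    linarith
  refine (integrableOn_rpow_mul_exp_neg_mul_rpow hs hα hc).congr_fun (fun y _ => ?_)
    measurableSet_Ioi
  simp only [finrank_euclideanSpace, Fintype.card_fin, smul_eq_mul, Real.rpow_natCast, pow_add]
  ring

variable {d : ℕ} {α c : ℝ} (Λ : Measure (Sph d))

theorem norm_cexp_neg_charExp_le (hle : ∀ z : Ed d, c * ‖z‖ ^ α ≤ (charExp d α Λ z).re)
    (z : Ed d) : ‖Complex.exp (-charExp d α Λ z)‖ ≤ Real.exp (-c * ‖z‖ ^ α) := by
  rw [Complex.norm_exp, Complex.neg_re, neg_mul]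
  gcongr
  exact hle z

variable [IsFiniteMeasure Λ]

theorem integrable_inner_pow_mul_cexp (hd : 1 ≤ d) (hα : 0 < α) (hc : 0 < c)
    (hle : ∀ z : Ed d, c * ‖z‖ ^ α ≤ (charExp d α Λ z).re) (x : Ed d) (k : ℕ) :
    Integrable fun z : Ed d => ((⟪x, z⟫ : ℝ) : ℂ) ^ k * Complex.exp (-charExp d α Λ z) := by
  have hcont := continuous_charExp Λ hα
  refine ((integrable_norm_pow_mul_exp hd hα hc k).const_mul (‖x‖ ^ k)).mono'
    (Continuous.aestronglyMeasurable (by fun_prop)) (.of_forall fun z => ?_)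
  rw [norm_mul, norm_pow, Complex.norm_real, ← mul_assoc, ← mul_pow]
  gcongr
  · exact norm_inner_le_norm x z
  · exact norm_cexp_neg_charExp_le Λ hle z

/-- Moments of the inverse Fourier integrand, computed in polar coordinates. -/
theorem integral_inner_pow_mul_cexp (hd : 1 ≤ d) (hα : 0 < α) (hc : 0 < c)
    (hle : ∀ z : Ed d, c * ‖z‖ ^ α ≤ (charExp d α Λ z).re) (x : Ed d) (k : ℕ) :
    ∫ z : Ed d, ((⟪x, z⟫ : ℝ) : ℂ) ^ k * Complex.exp (-charExp d α Λ z) =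
      ((1 / α * Real.Gamma (((k : ℝ) + d) / α) : ℝ) : ℂ) *
        ∫ u : Sph d, ((⟪x, (u : Ed d)⟫ : ℝ) : ℂ) ^ k *
          Vfun d α Λ u ^ ((-(((k : ℝ) + d) / α) : ℝ) : ℂ) ∂(ωd d) := by
  rw [integral_eq_integral_sphere hd (integrable_inner_pow_mul_cexp Λ hd hα hc hle x k),
    ← integral_const_mul]
  refine integral_congr_ae (.of_forall fun u => ?_)
  have hu : ‖(u : Ed d)‖ = 1 := norm_eq_of_mem_sphere u
  have hV : 0 < (Vfun d α Λ u).re := by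
    have := hle u
    rw [hu, Real.one_rpow, mul_one] at this
    exact hc.trans_le this
  have hq : (-1 : ℝ) < ((k + d - 1 : ℕ) : ℝ) := by
    have := Nat.cast_nonneg (α := ℝ) (k + d - 1)
    linarith
  have hqd : ((k + d - 1 : ℕ) : ℝ) + 1 = k + d := by
    rw [← Nat.cast_add_one, Nat.sub_add_cancel (by omega), Nat.cast_add]
  have key := integral_rpow_mul_cexp hα hq hV
  rw [hqd] at key
  calc
    _ = ∫ r in Set.Ioi (0 : ℝ), ((⟪x, (u : Ed d)⟫ : ℝ) : ℂ) ^ k *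
          (((r ^ ((k + d - 1 : ℕ) : ℝ) : ℝ) : ℂ) *
            Complex.exp (-Vfun d α Λ u * ((r ^ α : ℝ) : ℂ))) := by
      refine setIntegral_congr_fun measurableSet_Ioi fun r hr => ?_
      rw [charExp_smul Λ hr, real_inner_smul_right, Real.rpow_natCast, Vfun,
        show k + d - 1 = (d - 1) + k by omega, pow_add]
      push_cast
      ring_nf
    _ = _ := by
      rw [integral_const_mul, key]
      ring

/-- Taylor's inequality for the exponential on the imaginary axis. -/
theorem norm_cexp_neg_I_mul_sub_sum_le (y : ℝ) (n : ℕ) :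
    ‖Complex.exp (-(Complex.I * y)) -
        ∑ k ∈ Finset.range (n + 1), (-(Complex.I * y)) ^ k / (Nat.factorial k : ℂ)‖ ≤
      (n + 3) * |y| ^ (n + 1) := by
  have hnorm : ‖-(Complex.I * (y : ℂ))‖ = |y| := by simp
  rcases le_or_gt |y| 1 with hy | hy
  · refine (Complex.norm_exp_sub_sum_le_norm_mul_exp _ _).trans ?_
    rw [hnorm, mul_comm]
    gcongr
    have h1 : Real.exp |y| ≤ Real.exp 1 := Real.exp_le_exp.2 hy
    have h2 := Real.exp_one_lt_d9
    have h3 := Nat.cast_nonneg (α := ℝ) n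
    linarith
  · have hexp : ‖Complex.exp (-(Complex.I * (y : ℂ)))‖ = 1 := by
      rw [Complex.norm_exp]
      simp
    have hone : 1 ≤ |y| ^ (n + 1) := one_le_pow₀ hy.le
    have hsum : ‖∑ k ∈ Finset.range (n + 1), (-(Complex.I * (y : ℂ))) ^ k / (Nat.factorial k : ℂ)‖ ≤
        (n + 1) * |y| ^ (n + 1) := by
      have hcard : ∑ _k ∈ Finset.range (n + 1), |y| ^ (n + 1) = (n + 1) * |y| ^ (n + 1) := by simp
      refine (norm_sum_le_of_le _ fun k hk => ?_).trans_eq hcard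
      rw [norm_div, norm_pow, hnorm, Complex.norm_natCast]
      refine (div_le_self (by positivity) ?_).trans
        (pow_le_pow_right₀ hy.le (Finset.mem_range.1 hk).le)
      exact_mod_cast Nat.one_le_iff_ne_zero.2 (Nat.factorial_ne_zero k)
    refine (norm_sub_le _ _).trans ?_
    rw [hexp]
    linarith

theorem norm_integral_sub_sum_moments_le (hd : 1 ≤ d) (hα : 0 < α) (hc : 0 < c)
    (hle : ∀ z : Ed d, c * ‖z‖ ^ α ≤ (charExp d α Λ z).re) (x : Ed d) (n : ℕ) :
    ‖(∫ z : Ed d, Complex.exp (-(Complex.I * (⟪x, z⟫ : ℂ))) * Complex.exp (-charExp d α Λ z)) -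
        ∑ k ∈ Finset.range (n + 1), (-Complex.I) ^ k / (Nat.factorial k : ℂ) *
          ∫ z : Ed d, ((⟪x, z⟫ : ℝ) : ℂ) ^ k * Complex.exp (-charExp d α Λ z)‖ ≤
      ((n + 3) * ∫ z : Ed d, ‖z‖ ^ (n + 1) * Real.exp (-c * ‖z‖ ^ α)) * ‖x‖ ^ (n + 1) := by
  have hcont := continuous_charExp Λ hα
  have hint : Integrable fun z : Ed d =>
      Complex.exp (-(Complex.I * (⟪x, z⟫ : ℂ))) * Complex.exp (-charExp d α Λ z) := by
    refine (integrable_inner_pow_mul_cexp Λ hd hα hc hle x 0).norm.mono'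
      (Continuous.aestronglyMeasurable (by fun_prop)) (.of_forall fun z => ?_)
    rw [norm_mul, norm_mul, pow_zero, norm_one, Complex.norm_exp]
    simp
  have hintk : ∀ k ∈ Finset.range (n + 1), Integrable fun z : Ed d =>
      (-Complex.I) ^ k / (Nat.factorial k : ℂ) *
        (((⟪x, z⟫ : ℝ) : ℂ) ^ k * Complex.exp (-charExp d α Λ z)) := fun k _ =>
    (integrable_inner_pow_mul_cexp Λ hd hα hc hle x k).const_mul _
  rw [Finset.sum_congr rfl fun k _ => (integral_const_mul _ _).symm,
    ← integral_finsetSum _ hintk, ← integral_sub hint (integrable_finsetSum _ hintk),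
    ← integral_const_mul, ← integral_mul_const]
  refine norm_integral_le_of_norm_le
    (((integrable_norm_pow_mul_exp hd hα hc (n + 1)).const_mul _).mul_const _)
    (.of_forall fun z => ?_)
  have hsum : ∑ k ∈ Finset.range (n + 1), (-Complex.I) ^ k / (Nat.factorial k : ℂ) *
        (((⟪x, z⟫ : ℝ) : ℂ) ^ k * Complex.exp (-charExp d α Λ z)) =
      (∑ k ∈ Finset.range (n + 1),
        (-(Complex.I * (⟪x, z⟫ : ℂ))) ^ k / (Nat.factorial k : ℂ)) *
          Complex.exp (-charExp d α Λ z) := by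
    rw [Finset.sum_mul]
    refine Finset.sum_congr rfl fun k _ => ?_
    rw [← neg_mul, mul_pow]
    ring
  rw [hsum, ← sub_mul, norm_mul]
  calc
    _ ≤ ((n + 3) * |⟪x, z⟫| ^ (n + 1)) * Real.exp (-c * ‖z‖ ^ α) := by
      gcongr
      · exact norm_cexp_neg_I_mul_sub_sum_le _ _
      · exact norm_cexp_neg_charExp_le Λ hle z
    _ ≤ ((n + 3) * (‖x‖ * ‖z‖) ^ (n + 1)) * Real.exp (-c * ‖z‖ ^ α) := by
      gcongr
      exact abs_real_inner_le_norm x z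
    _ = _ := by ring

end Moments
section Expansion

variable {d : ℕ} {α : ℝ} (Λ : Measure (Sph d))

theorem Gamma_mul_sphereArea (hd : 1 ≤ d) :
    Real.Gamma ((d : ℝ) / 2) * sphereArea d = 2 * Real.pi ^ ((d : ℝ) / 2) := by
  have hd' : (0 : ℝ) < d := by exact_mod_cast hd
  rw [sphereArea, mul_div_cancel₀ _ (Real.Gamma_pos_of_pos (by positivity)).ne']

theorem sphereArea_pos (hd : 1 ≤ d) : 0 < sphereArea d := by
  have hd' : (0 : ℝ) < d := by exact_mod_cast hd
  have := Real.Gamma_pos_of_pos (half_pos hd')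
  rw [sphereArea]
  positivity

theorem sphereArea_mul_SHp (hd : 1 ≤ d) (j : ℕ) (p : ℝ) (u : Sph d) :
    (sphereArea d : ℂ) * SHp d α Λ j p u = (-Complex.I) ^ j *
      ∫ v : Sph d, (zonal d ⟪(u : Ed d), (v : Ed d)⟫ j : ℂ) * Vfun d α Λ v ^ (p : ℂ) ∂(ωd d) := by
  have hA : (sphereArea d : ℂ) ≠ 0 := Complex.ofReal_ne_zero.2 (sphereArea_pos hd).ne'
  simp only [zonal, Complex.ofReal_mul, Complex.ofReal_natCast, mul_assoc]
  rw [integral_const_mul, SHp, projC]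
  field_simp

theorem inv_two_pi_pow_mul (d : ℕ) :
    ((2 * Real.pi) ^ d)⁻¹ * (2 * Real.pi ^ ((d : ℝ) / 2)) =
      (2 : ℝ) ^ (1 - (d : ℝ)) / Real.pi ^ ((d : ℝ) / 2) := by
  have hpi : Real.pi ^ d = Real.pi ^ ((d : ℝ) / 2) * Real.pi ^ ((d : ℝ) / 2) := by
    rw [← Real.rpow_add Real.pi_pos, add_halves, Real.rpow_natCast]
  have hpos : 0 < Real.pi ^ ((d : ℝ) / 2) := Real.rpow_pos_of_pos Real.pi_pos _
  rw [Real.rpow_sub two_pos, Real.rpow_one, Real.rpow_natCast, mul_pow, hpi]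
  field_simp

variable [IsFiniteMeasure Λ]

theorem continuous_Vfun_cpow (hα : 0 < α) (hV : ∀ u : Sph d, 0 < (Vfun d α Λ u).re) (p : ℂ) :
    Continuous fun u : Sph d => Vfun d α Λ u ^ p :=
  ((continuous_charExp Λ hα).comp continuous_subtype_val).cpow continuous_const
    fun u => Or.inl (hV u)

/-- The expansion of a power of `⟪u, v⟫` in zonal harmonics, integrated against `V ^ p`. -/
theorem integral_inner_pow_mul_cpow (hd : 2 ≤ d) (hα : 0 < α)
    (hV : ∀ u : Sph d, 0 < (Vfun d α Λ u).re) (p : ℝ) (k : ℕ) (u : Sph d) :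
    (-Complex.I) ^ k / (Nat.factorial k : ℂ) *
        ∫ v : Sph d, ((⟪(u : Ed d), (v : Ed d)⟫ : ℝ) : ℂ) ^ k *
          Vfun d α Λ v ^ (p : ℂ) ∂(ωd d) =
      ((2 * Real.pi ^ ((d : ℝ) / 2) / 2 ^ k : ℝ) : ℂ) *
        ∑ m ∈ Finset.range (k / 2 + 1),
          (((-1 : ℝ) ^ m / ((Nat.factorial m : ℝ) *
              Real.Gamma ((k : ℝ) - m + (d : ℝ) / 2)) : ℝ) : ℂ) * SHp d α Λ (k - 2 * m) p u := by
  have hzonal : ∀ j, Continuous fun v : Sph d => (zonal d ⟪(u : Ed d), (v : Ed d)⟫ j : ℂ) :=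
    fun j => Complex.continuous_ofReal.comp
      (((continuous_gegenbauerN _ j).comp (by fun_prop)).const_mul _)
  have hint : ∀ j, Integrable (fun v : Sph d =>
      (zonal d ⟪(u : Ed d), (v : Ed d)⟫ j : ℂ) * Vfun d α Λ v ^ (p : ℂ)) (ωd d) := fun j =>
    ((hzonal j).mul (continuous_Vfun_cpow Λ hα hV p)).integrable_of_hasCompactSupport
      (HasCompactSupport.of_compactSpace _)
  have hpow : ∀ v : Sph d, (Nat.factorial k : ℂ)⁻¹ * (((⟪(u : Ed d), (v : Ed d)⟫ : ℝ) : ℂ) ^ k *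
      Vfun d α Λ v ^ (p : ℂ)) = ∑ m ∈ Finset.range (k / 2 + 1),
        ((Real.Gamma ((d : ℝ) / 2) / 2 ^ k / ((Nat.factorial m : ℝ) *
          Real.Gamma ((k : ℝ) - m + (d : ℝ) / 2)) : ℝ) : ℂ) *
            ((zonal d ⟪(u : Ed d), (v : Ed d)⟫ (k - 2 * m) : ℂ) * Vfun d α Λ v ^ (p : ℂ)) :=
      fun v => by
    have h := congrArg (fun s : ℝ => (s : ℂ) * Vfun d α Λ v ^ (p : ℂ))
      (pow_div_factorial_eq_sum_zonal hd ⟪(u : Ed d), (v : Ed d)⟫ k)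
    simp only [Finset.mul_sum, Complex.ofReal_sum, Finset.sum_mul] at h
    calc
      _ = ((⟪(u : Ed d), (v : Ed d)⟫ ^ k / (Nat.factorial k : ℝ) : ℝ) : ℂ) *
          Vfun d α Λ v ^ (p : ℂ) := by
        push_cast
        ring
      _ = _ := h
      _ = _ := by
        refine Finset.sum_congr rfl fun m _ => ?_
        push_cast
        ring
  rw [div_eq_mul_inv, mul_assoc, ← integral_const_mul, integral_congr_ae (.of_forall hpow),
    integral_finsetSum _ fun m _ => (hint _).const_mul _, Finset.mul_sum, Finset.mul_sum]
  refine Finset.sum_congr rfl fun m hm => ?_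
  have hk : (-Complex.I) ^ k = (-1) ^ m * (-Complex.I) ^ (k - 2 * m) := by
    have hm' : 2 * m ≤ k := by
      have := Finset.mem_range.1 hm
      omega
    nth_rw 1 [← Nat.add_sub_cancel' hm', pow_add, pow_mul, neg_sq, Complex.I_sq]
  have hS := sphereArea_mul_SHp (α := α) Λ (by omega : 1 ≤ d) (k - 2 * m) p u
  rw [integral_const_mul, hk, ← Gamma_mul_sphereArea (by omega : 1 ≤ d)]
  push_cast
  linear_combination (-((Real.Gamma ((d : ℝ) / 2) : ℂ) / 2 ^ k / ((Nat.factorial m : ℂ) *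
    (Real.Gamma ((k : ℝ) - m + (d : ℝ) / 2) : ℂ)) * (-1) ^ m)) * hS

end Expansion

/-- Proposition: asymptotic expansion of the density at `0` for `α ∈ (0,1)`, and the
value `g(0) = (Γ(d/α)/(α(2π)^d)) ∫ V^{-d/α} dω`. -/
theorem stmt13 (d : ℕ) (hd : 2 ≤ d) (α : ℝ) (hα0 : 0 < α) (hα1 : α < 1)
    (Λ : Measure (Sph d)) [IsFiniteMeasure Λ] (hΛ : Λ ≠ 0)
    (μ : Measure (Ed d)) [IsProbabilityMeasure μ] (hμ : IsStableChar d α Λ μ)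
    (hnd : Nondegenerate d μ)
    (g : Ed d → ℝ) (hg : IsDensityOf d α Λ g) :
    (∀ n : ℕ, ∃ C δ : ℝ, 0 < δ ∧ ∀ (x : Ed d) (hx : x ≠ 0), ‖x‖ ≤ δ →
      ‖(g x : ℂ) -
        (((2 : ℝ) ^ (1 - (d : ℝ)) / (Real.pi ^ ((d : ℝ) / 2) * α) : ℝ) : ℂ) *
          ∑ k ∈ Finset.range (n + 1),
            ((Real.Gamma (((k : ℝ) + d) / α) * (‖x‖ / 2) ^ k : ℝ) : ℂ) *
              ∑ m ∈ Finset.range (k / 2 + 1),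
                (((-1 : ℝ) ^ m / ((Nat.factorial m : ℝ) *
                    Real.Gamma ((k : ℝ) - m + (d : ℝ) / 2)) : ℝ) : ℂ) *
                  SHp d α Λ (k - 2 * m) (-(((k : ℝ) + d) / α)) (unitize x hx)‖
        ≤ C * ‖x‖ ^ (n + 1)) ∧
    (g 0 : ℂ) = ((Real.Gamma ((d : ℝ) / α) / (α * (2 * Real.pi) ^ d) : ℝ) : ℂ) *
      ∫ u, (Vfun d α Λ u) ^ ((-((d : ℝ) / α) : ℝ) : ℂ) ∂(ωd d) := by
  obtain ⟨c, hc, hle⟩ := exists_le_charExp_re Λ hα0 fun z hz => charExp_re_pos Λ hα0 hμ hnd hz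
  have hd1 : 1 ≤ d := by omega
  have hV : ∀ u : Sph d, 0 < (Vfun d α Λ u).re := fun u =>
    charExp_re_pos Λ hα0 hμ hnd (ne_zero_of_mem_unit_sphere u)
  constructor
  · intro n
    refine ⟨((2 * Real.pi) ^ d)⁻¹ *
      ((n + 3) * ∫ z : Ed d, ‖z‖ ^ (n + 1) * Real.exp (-c * ‖z‖ ^ α)), 1, one_pos,
      fun x hx _ => ?_⟩
    have hbound := norm_integral_sub_sum_moments_le Λ hd1 hα0 hc hle x n
    have hterm : ∀ k : ℕ, ((((2 * Real.pi) ^ d)⁻¹ : ℝ) : ℂ) *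
        ((-Complex.I) ^ k / (Nat.factorial k : ℂ) *
          ∫ z : Ed d, ((⟪x, z⟫ : ℝ) : ℂ) ^ k * Complex.exp (-charExp d α Λ z)) =
        (((2 : ℝ) ^ (1 - (d : ℝ)) / (Real.pi ^ ((d : ℝ) / 2) * α) : ℝ) : ℂ) *
          (((Real.Gamma (((k : ℝ) + d) / α) * (‖x‖ / 2) ^ k : ℝ) : ℂ) *
            ∑ m ∈ Finset.range (k / 2 + 1),
              (((-1 : ℝ) ^ m / ((Nat.factorial m : ℝ) *
                  Real.Gamma ((k : ℝ) - m + (d : ℝ) / 2)) : ℝ) : ℂ) *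
                SHp d α Λ (k - 2 * m) (-(((k : ℝ) + d) / α)) (unitize x hx)) := fun k => by
      have hinner : ∀ u : Sph d,
          ((⟪x, (u : Ed d)⟫ : ℝ) : ℂ) ^ k * Vfun d α Λ u ^ ((-(((k : ℝ) + d) / α) : ℝ) : ℂ) =
          (‖x‖ : ℂ) ^ k * (((⟪(unitize x hx : Ed d), (u : Ed d)⟫ : ℝ) : ℂ) ^ k *
            Vfun d α Λ u ^ ((-(((k : ℝ) + d) / α) : ℝ) : ℂ)) := fun u => by
        have hxu : x = ‖x‖ • (unitize x hx : Ed d) :=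
          (smul_inv_smul₀ (norm_ne_zero_iff.2 hx) x).symm
        nth_rw 1 [hxu]
        rw [real_inner_smul_left, Complex.ofReal_mul, mul_pow, mul_assoc]
      have hexp := integral_inner_pow_mul_cpow Λ hd hα0 hV (-(((k : ℝ) + d) / α)) k (unitize x hx)
      rw [integral_inner_pow_mul_cexp Λ hd1 hα0 hc hle, integral_congr_ae (.of_forall hinner),
        integral_const_mul, ← div_div, ← inv_two_pi_pow_mul,
        div_pow ‖x‖]
      generalize (∑ m ∈ Finset.range (k / 2 + 1), _ : ℂ) = S at hexp ⊢
      push_cast at hexp ⊢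
      linear_combination (((2 * (Real.pi : ℂ)) ^ d)⁻¹ * (1 / (α : ℂ) *
        (Real.Gamma (((k : ℝ) + d) / α) : ℂ)) * (‖x‖ : ℂ) ^ k) * hexp
    rw [hg x, Finset.mul_sum, ← Finset.sum_congr rfl fun k _ => hterm k, ← Finset.mul_sum,
      ← mul_sub, norm_mul, Complex.norm_real, Real.norm_of_nonneg (by positivity), mul_assoc]
    gcongr
  · have h0 := integral_inner_pow_mul_cexp Λ hd1 hα0 hc hle 0 0
    simp only [pow_zero, one_mul, Nat.cast_zero, zero_add] at h0
    rw [hg 0]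
    simp only [inner_zero_left, Complex.ofReal_zero, mul_zero, neg_zero, Complex.exp_zero, one_mul]
    rw [h0, ← mul_assoc, ← Complex.ofReal_mul]
    congr 2
    field_simp

end StablePaper
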